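/- The stabilizer in GL(4, ZMod 3) of a fixed demicap with anchor 0 (as a set of 10 points) has order 240 and is isomorphic to S_5 × Z/2Z. -/

import Mathlib

abbrev V4 := Fin 4 → ZMod 3

def IsCap (C : Set V4) : Prop :=
  ∀ a ∈ C, ∀ b ∈ C, ∀ c ∈ C, a ≠ b → a ≠ c → b ≠ c → a + b + c ≠ 0

def IsDemicap (a : V4) (D : Set V4) : Prop :=
  D.ncard = 10 ∧ IsCap D ∧
  ∃ d d' : Fin 5 → V4,
    (∀ i, a + d i + d' i = 0) ∧
    D = Set.range d ∪ Set.range d' ∧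
    ¬ ∃ s : Finset (Fin 5), s.card = 4 ∧
      ∃ W : Submodule (ZMod 3) V4, Module.finrank (ZMod 3) W = 3 ∧
        ∀ i ∈ s, d i - a ∈ W

open scoped Pointwise

lemma units_zmod3 (u : (ZMod 3)ˣ) : u = 1 ∨ u = -1 := by
  revert u; decide

lemma exists_ker {p : Submodule (ZMod 3) V4} (hp : p ≠ ⊤) :
    ∃ W : Submodule (ZMod 3) V4, Module.finrank (ZMod 3) W = 3 ∧ p ≤ W := by
  obtain ⟨f, hf, hle⟩ := Submodule.exists_le_ker_of_lt_top p (lt_top_iff_ne_top.mpr hp)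
  refine ⟨LinearMap.ker f, ?_, hle⟩
  have := Module.Dual.finrank_ker_add_one_of_ne_zero (f := f) hf
  simp at this
  omega

lemma normal_form (D : Set V4) (h : IsDemicap 0 D) :
    ∃ (b : Module.Basis (Fin 4) (ZMod 3) V4) (e : Fin 5 → V4),
      (∀ i : Fin 4, e i.castSucc = b i) ∧ ∑ i, e i = 0 ∧
      ∀ x, x ∈ D ↔ ∃ (i : Fin 5) (u : (ZMod 3)ˣ), x = u • e i := by
  obtain ⟨-, -, d, d', hdd, hD, hn⟩ := h
  have hspan : ⊤ ≤ Submodule.span (ZMod 3) (Set.range (fun i : Fin 4 => d i.castSucc)) := by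
    by_contra hne
    obtain ⟨W, hW, hle⟩ := exists_ker (fun h => hne h.ge)
    refine hn ⟨Finset.univ.erase (Fin.last 4), by simp, W, hW, fun i hi => ?_⟩
    rw [sub_zero]
    apply hle
    apply Submodule.subset_span
    have hi' : i ≠ Fin.last 4 := by simpa using hi
    exact ⟨i.castPred hi', by simp⟩
  let b0 : Module.Basis (Fin 4) (ZMod 3) V4 :=
    basisOfTopLeSpanOfCardEqFinrank _ hspan (by simp)
  have hb0 : ∀ i, b0 i = d i.castSucc := fun i => by simp [b0]
  have hc : ∀ i, b0.repr (d (Fin.last 4)) i ≠ 0 := by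
    intro i hi
    have hne : LinearMap.ker (b0.coord i) ≠ ⊤ := by
      intro ht
      have : b0 i ∈ LinearMap.ker (b0.coord i) := by rw [ht]; trivial
      simp at this
    obtain ⟨W, hW, hle⟩ := exists_ker hne
    refine hn ⟨Finset.univ.erase i.castSucc, by simp, W, hW, fun j hj => ?_⟩
    rw [sub_zero]
    apply hle
    have hj' : j ≠ i.castSucc := by simpa using hj
    induction j using Fin.lastCases with
    | last => simpa using hi
    | cast j =>
      have : j ≠ i := fun h => hj' (by rw [h])
      simp [← hb0, this]
  let w : Fin 4 → (ZMod 3)ˣ := fun i => - Units.mk0 _ (hc i)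
  let w5 : Fin 5 → (ZMod 3)ˣ := Fin.snoc (α := fun _ => (ZMod 3)ˣ) w 1
  refine ⟨b0.unitsSMul w, fun i => w5 i • d i, fun i => ?_, ?_, fun x => ?_⟩
  · simp [w5, Module.Basis.unitsSMul_apply, hb0]
  · rw [Fin.sum_univ_castSucc]
    have h1 := b0.sum_repr (d (Fin.last 4))
    simp only [w5, w, Fin.snoc_castSucc, Fin.snoc_last, one_smul]
    have h2 : ∀ i : Fin 4, (-Units.mk0 _ (hc i)) • d i.castSucc
        = -(b0.repr (d (Fin.last 4)) i • b0 i) := fun i => by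
      rw [hb0, Units.smul_def, Units.val_neg, Units.val_mk0, neg_smul]
    rw [Finset.sum_congr rfl fun i _ => h2 i, Finset.sum_neg_distrib, h1, neg_add_cancel]
  · have hd' : ∀ i, d' i = - d i := fun i => by
      have := hdd i
      rw [zero_add] at this
      exact (neg_eq_of_add_eq_zero_right this).symm
    have key : ∀ i, (∃ u : (ZMod 3)ˣ, x = u • (w5 i • d i)) ↔ (x = d i ∨ x = d' i) := by
      intro i
      rw [hd']
      constructor
      · rintro ⟨u, rfl⟩
        rw [smul_smul]
        rcases units_zmod3 (u * w5 i) with h | h <;> rw [h] <;> simp [Units.smul_def]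
      · rintro (rfl | rfl)
        · exact ⟨(w5 i)⁻¹, by simp⟩
        · exact ⟨-(w5 i)⁻¹, by
            rw [smul_smul, neg_mul, inv_mul_cancel, Units.smul_def, Units.val_neg, Units.val_one,
              neg_smul, one_smul]⟩
    simp only [key, hD, Set.mem_union, Set.mem_range]
    constructor
    · rintro (⟨i, rfl⟩ | ⟨i, rfl⟩)
      · exact ⟨i, Or.inl rfl⟩
      · exact ⟨i, Or.inr rfl⟩
    · rintro ⟨i, rfl | rfl⟩
      · exact Or.inl ⟨i, rfl⟩
      · exact Or.inr ⟨i, rfl⟩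

section
variable (b : Module.Basis (Fin 4) (ZMod 3) V4) (e : Fin 5 → V4)

lemma rel_const (hb : ∀ i : Fin 4, e i.castSucc = b i) (hs : ∑ i, e i = 0)
    (c : Fin 5 → ZMod 3) (hc : ∑ i, c i • e i = 0) : ∀ i, c i = c (Fin.last 4) := by
  have h1 : ∑ i, (c i - c (Fin.last 4)) • e i = 0 := by
    simp only [sub_smul, Finset.sum_sub_distrib, hc, ← Finset.smul_sum, hs]; simp
  rw [Fin.sum_univ_castSucc] at h1
  simp only [sub_self, zero_smul, add_zero, hb] at h1
  have h2 := Fintype.linearIndependent_iff.mp b.linearIndependent _ h1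
  intro i
  induction i using Fin.lastCases with
  | last => rfl
  | cast i => exact sub_eq_zero.mp (h2 i)

/-- The linear map attached to a permutation and a sign. -/
noncomputable def Tmap (p : Equiv.Perm (Fin 5) × (ZMod 3)ˣ) : Module.End (ZMod 3) V4 :=
  b.constr (ZMod 3) (fun i => p.2 • e (p.1 i.castSucc))

lemma Tmap_apply (hb : ∀ i : Fin 4, e i.castSucc = b i) (hs : ∑ i, e i = 0)
    (p : Equiv.Perm (Fin 5) × (ZMod 3)ˣ) (i : Fin 5) : Tmap b e p (e i) = p.2 • e (p.1 i) := by
  have hc : ∀ i : Fin 4, Tmap b e p (e i.castSucc) = p.2 • e (p.1 i.castSucc) := fun i => by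
    rw [hb, Tmap, Module.Basis.constr_basis]
  induction i using Fin.lastCases with
  | cast i => exact hc i
  | last =>
    have h1 : ∑ i, Tmap b e p (e i) = 0 := by rw [← map_sum, hs, map_zero]
    have h2 : ∑ i, p.2 • e (p.1 i) = 0 := by
      rw [← Finset.smul_sum, Equiv.sum_comp p.1 e, hs, smul_zero]
    rw [Fin.sum_univ_castSucc] at h1 h2
    simp only [hc] at h1
    exact add_left_cancel (h1.trans h2.symm)

lemma e_ext (hb : ∀ i : Fin 4, e i.castSucc = b i) {f g : Module.End (ZMod 3) V4}
    (h : ∀ i, f (e i) = g (e i)) : f = g :=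
  b.ext fun i => by rw [← hb]; exact h _

/-- The representation as a monoid homomorphism. -/
noncomputable def Thom (hb : ∀ i : Fin 4, e i.castSucc = b i) (hs : ∑ i, e i = 0) :
    Equiv.Perm (Fin 5) × (ZMod 3)ˣ →* Module.End (ZMod 3) V4 where
  toFun := Tmap b e
  map_one' := e_ext b e hb fun i => by rw [Tmap_apply b e hb hs]; simp
  map_mul' p q := e_ext b e hb fun i => by
    rw [Module.End.mul_apply, Tmap_apply b e hb hs, Tmap_apply b e hb hs]
    have : Tmap b e p (q.2 • e (q.1 i)) = q.2 • Tmap b e p (e (q.1 i)) := by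
      simp [Units.smul_def]
    rw [this, Tmap_apply b e hb hs, smul_smul, mul_comm]
    simp

/-- The representation into the linear group. -/
noncomputable def Ghom (hb : ∀ i : Fin 4, e i.castSucc = b i) (hs : ∑ i, e i = 0) :
    Equiv.Perm (Fin 5) × (ZMod 3)ˣ →* (V4 ≃ₗ[ZMod 3] V4) :=
  (LinearMap.GeneralLinearGroup.generalLinearEquiv (ZMod 3) V4).toMonoidHom.comp
    (Thom b e hb hs).toHomUnits

lemma Ghom_apply (hb : ∀ i : Fin 4, e i.castSucc = b i) (hs : ∑ i, e i = 0)
    (p : Equiv.Perm (Fin 5) × (ZMod 3)ˣ) (i : Fin 5) :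
    Ghom b e hb hs p (e i) = p.2 • e (p.1 i) :=
  Tmap_apply b e hb hs p i

lemma e_inj (hb : ∀ i : Fin 4, e i.castSucc = b i) (hs : ∑ i, e i = 0)
    {i j : Fin 5} {u v : (ZMod 3)ˣ} (h : u • e i = v • e j) : i = j ∧ u = v := by
  have h0 : ∑ k, ((Pi.single i (u : ZMod 3) : Fin 5 → ZMod 3) k
      - (Pi.single j (v : ZMod 3) : Fin 5 → ZMod 3) k) • e k = 0 := by
    simp only [sub_smul, Finset.sum_sub_distrib, Pi.single_apply, ite_smul, zero_smul,
      Finset.sum_ite_eq', Finset.mem_univ, if_true]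
    rw [sub_eq_zero]; exact h
  have h1 := rel_const b e hb hs _ h0
  have hk : ∀ i j : Fin 5, ∃ k, k ≠ i ∧ k ≠ j := by decide
  obtain ⟨k, hki, hkj⟩ := hk i j
  have h2 := (h1 i).trans (h1 k).symm
  simp only [Pi.single_apply, if_neg hki, if_neg hkj, if_true, sub_zero] at h2
  by_cases hij : i = j
  · refine ⟨hij, Units.ext ?_⟩
    rw [if_pos hij] at h2
    exact sub_eq_zero.mp h2
  · rw [if_neg hij, sub_zero] at h2
    exact absurd h2 u.ne_zero

lemma Ghom_injective (hb : ∀ i : Fin 4, e i.castSucc = b i) (hs : ∑ i, e i = 0) :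
    Function.Injective (Ghom b e hb hs) := by
  intro p q h
  have h1 : ∀ i, p.1 i = q.1 i ∧ p.2 = q.2 := fun i => by
    apply e_inj b e hb hs
    rw [← Ghom_apply b e hb hs, ← Ghom_apply b e hb hs, h]
  exact Prod.ext (Equiv.ext fun i => (h1 i).1) (h1 0).2

lemma Ghom_range (hb : ∀ i : Fin 4, e i.castSucc = b i) (hs : ∑ i, e i = 0) (D : Set V4)
    (hD : ∀ x, x ∈ D ↔ ∃ (i : Fin 5) (u : (ZMod 3)ˣ), x = u • e i) :
    (Ghom b e hb hs).range = MulAction.stabilizer (V4 ≃ₗ[ZMod 3] V4) D := by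
  have hsm : ∀ (g : V4 ≃ₗ[ZMod 3] V4) (u : (ZMod 3)ˣ) (x : V4), g (u • x) = u • g x :=
    fun g u x => by simp [Units.smul_def]
  have hfin : D.Finite := Set.toFinite D
  ext g
  rw [MulAction.mem_stabilizer_set' hfin]
  constructor
  · rintro ⟨p, rfl⟩ x hx
    obtain ⟨i, u, rfl⟩ := (hD x).mp hx
    refine (hD _).mpr ⟨p.1 i, u * p.2, ?_⟩
    rw [LinearEquiv.smul_def, hsm, Ghom_apply, smul_smul]
  · intro hg
    have h1 : ∀ i, ∃ (j : Fin 5) (u : (ZMod 3)ˣ), g (e i) = u • e j := fun i =>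
      (hD _).mp (hg ((hD _).mpr ⟨i, 1, by simp⟩))
    choose s u hu using h1
    have hinj : Function.Injective s := by
      intro i j hij
      have h2 : g ((u i)⁻¹ • e i) = g ((u j)⁻¹ • e j) := by
        rw [hsm, hsm, hu, hu, inv_smul_smul, inv_smul_smul, hij]
      exact (e_inj b e hb hs (g.injective h2)).1
    let t : Equiv.Perm (Fin 5) := Equiv.ofBijective s (Finite.injective_iff_bijective.mp hinj)
    have hts : ∀ i, t i = s i := fun i => rfl
    have h3 : ∑ k, ((u (t.symm k) : (ZMod 3)ˣ) : ZMod 3) • e k = 0 := by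
      rw [← Equiv.sum_comp t]
      have h4 : ∑ i, g (e i) = 0 := by rw [← map_sum, hs, map_zero]
      rw [← h4]
      refine Finset.sum_congr rfl fun i _ => ?_
      rw [Equiv.symm_apply_apply, hu, hts, Units.smul_def]
    have h5 := rel_const b e hb hs _ h3
    refine ⟨(t, u (t.symm (Fin.last 4))), ?_⟩
    apply LinearEquiv.toLinearMap_injective
    apply e_ext b e hb
    intro i
    have h6 := h5 (t i)
    rw [Equiv.symm_apply_apply] at h6
    have h7 := Ghom_apply b e hb hs (t, u (t.symm (Fin.last 4))) i
    simp only [LinearEquiv.coe_coe]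
    rw [h7, hu, hts, Units.ext h6]

end

/-- The setwise stabilizer in the general linear group of a demicap with anchor 0
has order 240 and is isomorphic to `S₅ × ℤ/2ℤ`. -/
theorem stabilizer_of_demicap (D : Set V4) (h : IsDemicap 0 D) :
    Nat.card (MulAction.stabilizer (V4 ≃ₗ[ZMod 3] V4) D) = 240 ∧
    Nonempty (MulAction.stabilizer (V4 ≃ₗ[ZMod 3] V4) D ≃*
      Equiv.Perm (Fin 5) × Multiplicative (ZMod 2)) := by
  obtain ⟨b, e, hb, hs, hD⟩ := normal_form D h
  have E1 : MulAction.stabilizer (V4 ≃ₗ[ZMod 3] V4) D ≃* Equiv.Perm (Fin 5) × (ZMod 3)ˣ :=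
    ((MonoidHom.ofInjective (Ghom_injective b e hb hs)).trans
      (MulEquiv.subgroupCongr (Ghom_range b e hb hs D hD))).symm
  have E2 : (ZMod 3)ˣ ≃* Multiplicative (ZMod 2) :=
    mulEquivOfCyclicCardEq (by
      rw [Nat.card_eq_fintype_card, Nat.card_eq_fintype_card, ZMod.card_units_eq_totient]; rfl)
  have E := E1.trans (MulEquiv.prodCongr (MulEquiv.refl _) E2)
  refine ⟨?_, ⟨E⟩⟩
  rw [Nat.card_congr E.toEquiv, Nat.card_prod, Nat.card_eq_fintype_card, Fintype.card_perm]
  simp [Nat.factorial]
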